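/- Fix σ > 0 and let p = p(m) satisfy m·p(m)^{2/3} → σ as m → ∞. Let 𝖳_m be a uniformly random labelled tree on [m], rooted at 1 with canonical planar embedding, and add each of its a(𝖳_m) permitted edges independently with probability p; let 𝖱(m) be the number of added (surplus) edges, with heads 𝖻_{1,m},…,𝖻_{𝖱(m),m} listed in increasing planar order of the tails, and let 𝖶_i(m) be the number of descendants of 𝖻_{i,m} in 𝖳_m (including 𝖻_{i,m}). Then lim_{K→∞} limsup_{m→∞} P[Σ_{i=1}^{𝖱(m)} 𝖶_i(m) > K] = 0. -/

import Mathlib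

open Finset
open scoped Classical

namespace RandomTree

/-- The state of the depth-first exploration: the ordered stack of open vertices and the
list of explored vertices, in order of exploration. -/
structure St (m : ℕ) where
  stack : List (Fin m)
  visited : List (Fin m)

/-- One step of the depth-first exploration of the graph with adjacency `adj`. -/
def step {m : ℕ} (adj : Fin m → Fin m → Bool) (s : St m) : St m :=
  match s.stack with
  | [] => s
  | v :: rest =>
    let visited' := s.visited ++ [v]
    let ns := (List.finRange m).filter
      (fun w => adj v w && !(decide (w ∈ s.stack)) && !(decide (w ∈ s.visited)))
    let stack' := ns ++ rest
    let stack'' := if stack'.isEmpty then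
        ((List.finRange m).filter (fun w => !(decide (w ∈ visited')))).take 1
      else stack'
    ⟨stack'', visited', ⟩

/-- The state of the depth-first exploration started at the root `r` after `i` steps. -/
def stateAt {m : ℕ} (adj : Fin m → Fin m → Bool) (r : Fin m) (i : ℕ) : St m :=
  (step adj)^[i] ⟨[r], []⟩

/-- `par` is the parent map of a tree on `Fin m` rooted at `r`: iterating the parent map
from any vertex leads to the root. -/
def IsPTree {m : ℕ} (par : Fin m → Fin m) (r : Fin m) : Prop :=
  par r = r ∧ ∀ v, ∃ k : ℕ, par^[k] v = r

/-- The set of (parent maps of) labelled trees on `Fin m` rooted at `r`. -/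
noncomputable def treeFinset (m : ℕ) (r : Fin m) : Finset (Fin m → Fin m) :=
  univ.filter (fun par => IsPTree par r)

/-- The adjacency function of the canonical plane embedding of the tree with parent map
`par`: edges from each vertex to its children (children are listed in increasing order of
label by the exploration itself). -/
def childAdj {m : ℕ} (par : Fin m → Fin m) (r : Fin m) : Fin m → Fin m → Bool :=
  fun v w => decide (w ≠ r) && decide (par w = v)

/-- The depth-first (planar) order of the vertices of the tree, as a list
`[v₁, …, v_m]`. -/
def dfsOrder {m : ℕ} (par : Fin m → Fin m) (r : Fin m) : List (Fin m) :=
  (stateAt (childAdj par r) r m).visited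

/-- The position of a vertex in the depth-first (planar) order. -/
def dfsPos {m : ℕ} (par : Fin m → Fin m) (r : Fin m) (v : Fin m) : ℕ :=
  (dfsOrder par r).findIdx (fun w => decide (w = v))

/-- The number of vertices of the subtree rooted at `v` (including `v`). -/
noncomputable def subSize {m : ℕ} (par : Fin m → Fin m) (v : Fin m) : ℕ :=
  Set.ncard {w : Fin m | ∃ k : ℕ, par^[k] w = v}

/-- The number of vertices of the subtree rooted at `v` lying outside the largest of the
subtrees rooted at a child of `v`. -/
noncomputable def outsideLargest {m : ℕ} (par : Fin m → Fin m) (r : Fin m) (v : Fin m) : ℕ :=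
  subSize par v - (univ.filter (fun c : Fin m => c ≠ r ∧ par c = v)).sup (subSize par)


/-- The permitted edges of the plane tree with parent map `par`: ordered pairs `(u, v)`
of distinct vertices, with `u` before `v` in the planar order (so `u` is the tail and `v`
the head), which at some step of the depth-first exploration are simultaneously on the
stack. -/
noncomputable def permitted {m : ℕ} (par : Fin m → Fin m) (r : Fin m) :
    Finset (Fin m × Fin m) :=
  univ.filter (fun x : Fin m × Fin m => x.1 ≠ x.2 ∧
    dfsPos par r x.1 < dfsPos par r x.2 ∧
    ∃ i ≤ m, x.1 ∈ (stateAt (childAdj par r) r i).stack ∧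
      x.2 ∈ (stateAt (childAdj par r) r i).stack)

/-- The probability weight of a configuration `s` of surplus edges: each permitted edge
is added independently with probability `p`; configurations containing a non-permitted
edge get weight `0`. -/
noncomputable def surpW {m : ℕ} (p : ℝ) (par : Fin m → Fin m) (r : Fin m)
    (s : Fin m → Fin m → Bool) : ℝ :=
  if ∀ u w, s u w = true → (u, w) ∈ permitted par r then
    ∏ x ∈ permitted par r, (if s x.1 x.2 then p else 1 - p)
  else 0

/-- The probability that, for a uniformly random labelled tree on `[m]` rooted at `1`
with each permitted edge added independently with probability `p`, the total number of
descendants of the heads of the added (surplus) edges exceeds `K`. -/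
noncomputable def descSumProb (m : ℕ) (p : ℝ) (K : ℕ) : ℝ :=
  if h : 0 < m then
    let r : Fin m := ⟨0, h⟩
    (∑ par : Fin m → Fin m, ∑ s : Fin m → Fin m → Bool,
      (if IsPTree par r then (1:ℝ) else 0) * surpW p par r s *
        (if K < ∑ x ∈ (permitted par r).filter (fun x => s x.1 x.2 = true),
            subSize par x.2 then 1 else 0))
      / ((treeFinset m r).card : ℝ)
  else 0

end RandomTree

namespace RandomTree

theorem sum_powerset_card_mul_pow {ι : Type*} (C : Finset ι) (a b : ℕ) :
    ∑ B ∈ C.powerset, B.card * (a ^ B.card * b ^ (C.card - B.card))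
      = C.card * a * (a + b) ^ (C.card - 1) := by
  rw [sum_powerset_apply_card (fun i => i * (a ^ i * b ^ (C.card - i)))]
  rcases C.card with _ | s
  · simp
  · rw [sum_range_succ']
    simp only [Nat.add_sub_cancel, smul_eq_mul, zero_mul, mul_zero, add_zero]
    rw [add_pow, mul_sum]
    refine sum_congr rfl fun i _ => ?_
    have h := Nat.add_one_mul_choose_eq s i
    rw [Nat.add_sub_add_right]
    calc (s + 1).choose (i + 1) * ((i + 1) * (a ^ (i + 1) * b ^ (s - i)))
        = ((s + 1).choose (i + 1) * (i + 1)) * (a ^ (i + 1) * b ^ (s - i)) := by ring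
      _ = (s + 1) * a * (a ^ i * b ^ (s - i) * s.choose i) := by rw [← h]; ring

section Forests

variable {V : Type*} [Fintype V] [DecidableEq V]

/-- Parent maps of forests with root set `R` and set of non-root vertices `C`, extended by the
identity outside `C`. -/
noncomputable def forests (R C : Finset V) : Finset (V → V) :=
  univ.filter (fun f => (∀ x ∉ C, f x = x) ∧ (∀ x ∈ C, f x ∈ R ∪ C) ∧
    ∀ x ∈ C, ∃ k : ℕ, f^[k] x ∈ R)

theorem mem_forests {R C : Finset V} {f : V → V} :
    f ∈ forests R C ↔ (∀ x ∉ C, f x = x) ∧ (∀ x ∈ C, f x ∈ R ∪ C) ∧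
      ∀ x ∈ C, ∃ k : ℕ, f^[k] x ∈ R := by
  simp [forests]

theorem forests_empty (R : Finset V) : (forests R ∅).card = 1 := by
  rw [card_eq_one]
  refine ⟨id, ?_⟩
  ext f
  simp [mem_forests, funext_iff]

theorem card_forests_fiber {R C B : Finset V} (hRC : Disjoint R C) (hB : B ⊆ C) :
    ((forests R C).filter (fun f => C.filter (fun x => f x ∈ R) = B)).card
      = R.card ^ B.card * (forests B (C \ B)).card := by
  have hpi : (Fintype.piFinset (fun x : V => if x ∈ B then R else {x})).card
      = R.card ^ B.card := by
    rw [Fintype.card_piFinset]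
    have : ∀ x : V, (if x ∈ B then R else {x}).card = if x ∈ B then R.card else 1 := by
      intro x; split_ifs <;> simp
    simp only [this, prod_ite, prod_const]
    simp
  rw [← hpi, ← card_product]
  have hdisj : ∀ x ∈ R, x ∉ C := fun x hx hx' => disjoint_left.1 hRC hx hx'
  refine card_nbij'
    (fun f => ((fun x => if x ∈ B then f x else x), (fun x => if x ∈ B then x else f x)))
    (fun g => fun x => if x ∈ B then g.1 x else g.2 x) ?_ ?_ ?_ ?_
  · intro f hf
    simp only [coe_filter, Set.mem_ofPred_eq, mem_forests] at hf
    obtain ⟨⟨h1, h2, h3⟩, hfB⟩ := hf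
    have hmB : ∀ x, x ∈ B ↔ x ∈ C ∧ f x ∈ R := by intro x; rw [← hfB]; simp
    simp only [coe_product, Set.mem_prod, mem_coe, Fintype.mem_piFinset, mem_forests]
    refine ⟨?_, ?_, ?_, ?_⟩
    · intro x
      by_cases hx : x ∈ B
      · simpa [hx] using ((hmB x).1 hx).2
      · simp [hx]
    · intro x hx
      by_cases hxB : x ∈ B
      · simp [hxB]
      · simp only [hxB, if_false]
        exact h1 x (fun h => hx (by simp [h, hxB]))
    · intro x hx
      simp only [mem_sdiff] at hx
      have h4 := h2 x hx.1
      have h5 : f x ∉ R := fun h => hx.2 ((hmB x).2 ⟨hx.1, h⟩)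
      simp only [hx.2, if_false]
      simp only [mem_union, h5, false_or] at h4
      by_cases h6 : f x ∈ B <;> simp [h6, h4]
    · have key : ∀ k : ℕ, ∀ x ∈ C, f^[k] x ∈ R →
          ∃ l : ℕ, (fun x => if x ∈ B then x else f x)^[l] x ∈ B := by
        intro k
        induction k with
        | zero => intro x hx h; exact absurd hx (hdisj x h)
        | succ k ih =>
          intro x hx h
          by_cases hxB : x ∈ B
          · exact ⟨0, hxB⟩
          · have h5 : f x ∉ R := fun h => hxB ((hmB x).2 ⟨hx, h⟩)
            have h4 := h2 x hx
            simp only [mem_union, h5, false_or] at h4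
            obtain ⟨l, hl⟩ := ih (f x) h4 (by simpa using h)
            exact ⟨l + 1, by simpa [hxB] using hl⟩
      intro x hx
      obtain ⟨k, hk⟩ := h3 x (mem_sdiff.1 hx).1
      exact key k x (mem_sdiff.1 hx).1 hk
  · intro g hg
    simp only [coe_product, Set.mem_prod, mem_coe, Fintype.mem_piFinset, mem_forests] at hg
    obtain ⟨h0, h1, h2, h3⟩ := hg
    have hgR : ∀ x ∈ B, g.1 x ∈ R := by
      intro x hx; simpa [hx] using h0 x
    have hgC : ∀ x ∈ C, x ∉ B → g.2 x ∈ C := by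
      intro x hx hxB
      have := h2 x (by simp [hx, hxB])
      simp only [mem_union, mem_sdiff] at this
      rcases this with h | h
      · exact hB h
      · exact h.1
    simp only [coe_filter, Set.mem_ofPred_eq, mem_forests]
    refine ⟨⟨?_, ?_, ?_⟩, ?_⟩
    · intro x hx
      have hxB : x ∉ B := fun h => hx (hB h)
      simpa [hxB] using h1 x (by simp [hx])
    · intro x hx
      by_cases hxB : x ∈ B
      · simp [hxB, hgR x hxB]
      · simp [hxB, hgC x hx hxB]
    · have key : ∀ l : ℕ, ∀ x ∈ C, g.2^[l] x ∈ B →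
          ∃ k : ℕ, (fun x => if x ∈ B then g.1 x else g.2 x)^[k] x ∈ R := by
        intro l
        induction l with
        | zero =>
          intro x hx h
          have h' : x ∈ B := h
          exact ⟨1, by simpa [h'] using hgR x h'⟩
        | succ l ih =>
          intro x hx h
          by_cases hxB : x ∈ B
          · exact ⟨1, by simpa [hxB] using hgR x hxB⟩
          · obtain ⟨k, hk⟩ := ih (g.2 x) (hgC x hx hxB) (by simpa using h)
            exact ⟨k + 1, by simpa [hxB] using hk⟩
      intro x hx
      by_cases hxB : x ∈ B
      · exact key 0 x hx hxB
      · obtain ⟨l, hl⟩ := h3 x (by simp [hx, hxB])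
        exact key l x hx hl
    · ext x
      simp only [mem_filter]
      constructor
      · rintro ⟨hx, h⟩
        by_contra hxB
        simp only [hxB, if_false] at h
        exact hdisj _ h (hgC x hx hxB)
      · intro hx
        exact ⟨hB hx, by simpa [hx] using hgR x hx⟩
  · intro f hf
    funext x
    by_cases hx : x ∈ B <;> simp [hx]
  · intro g hg
    simp only [coe_product, Set.mem_prod, mem_coe, Fintype.mem_piFinset, mem_forests] at hg
    obtain ⟨h0, h1, -, -⟩ := hg
    ext x
    · by_cases hx : x ∈ B
      · simp [hx]
      · simpa [hx, eq_comm] using h0 x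
    · by_cases hx : x ∈ B
      · simpa [hx, eq_comm] using h1 x (by simp [hx])
      · simp [hx]

/-- The **Cayley formula** for rooted forests. -/
theorem card_forests (R C : Finset V) (hRC : Disjoint R C) :
    (forests R C).card * (R.card + C.card) = R.card * (R.card + C.card) ^ C.card := by
  induction hs : C.card using Nat.strong_induction_on generalizing R C with
  | _ s ih =>
    subst hs
    rcases C.eq_empty_or_nonempty with rfl | hC
    · simp [forests_empty]
    have hpos : 0 < C.card := hC.card_pos
    have hdec : (forests R C).card
        = ∑ B ∈ C.powerset, R.card ^ B.card * (forests B (C \ B)).card := by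
      rw [card_eq_sum_card_fiberwise (f := fun f => C.filter (fun x => f x ∈ R))
        (t := C.powerset) (fun f _ => mem_coe.2 (mem_powerset.2 (filter_subset _ _)))]
      exact sum_congr rfl fun B hB => card_forests_fiber hRC (mem_powerset.1 hB)
    have hmul : (forests R C).card * C.card
        = ∑ B ∈ C.powerset, B.card * (R.card ^ B.card * C.card ^ (C.card - B.card)) := by
      rw [hdec, sum_mul]
      refine sum_congr rfl fun B hB => ?_
      have hBC := mem_powerset.1 hB
      rcases B.eq_empty_or_nonempty with rfl | hBne
      · obtain ⟨x, hx⟩ := hC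
        have : forests ∅ C = ∅ := by
          ext f
          simp only [mem_forests, notMem_empty, exists_false, iff_false]
          exact fun h => h.2.2 x hx
        simp [this]
      · have hcard := card_sdiff_of_subset hBC
        have hle := card_le_card hBC
        have hBpos := hBne.card_pos
        have h := ih (C \ B).card (by omega) B (C \ B) disjoint_sdiff rfl
        have h2 : B.card + (C \ B).card = C.card := by omega
        rw [h2] at h
        rw [mul_assoc, h, hcard]
        ring
    rw [sum_powerset_card_mul_pow] at hmul
    have h3 : (forests R C).card = R.card * (R.card + C.card) ^ (C.card - 1) := by
      apply Nat.eq_of_mul_eq_mul_right hpos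
      rw [hmul]; ring
    rw [h3, mul_assoc, ← pow_succ, Nat.sub_add_cancel hpos]

/-- The Cayley formula for trees with a prescribed root. -/
theorem card_forests_singleton {S : Finset V} {v : V} (hv : v ∈ S) :
    ((forests {v} (S.erase v)).card : ℝ) = (S.card : ℝ) ^ S.card / (S.card : ℝ) ^ 2 := by
  have h := card_forests {v} (S.erase v) (by simp)
  have hpos : 0 < S.card := card_pos.2 ⟨v, hv⟩
  have hc : (S.erase v).card = S.card - 1 := card_erase_of_mem hv
  rw [hc, card_singleton, Nat.add_sub_cancel' hpos, one_mul] at h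
  have hR : ((forests {v} (S.erase v)).card : ℝ) * S.card = (S.card : ℝ) ^ (S.card - 1) := by
    exact_mod_cast h
  have hp : (0 : ℝ) < S.card := by exact_mod_cast hpos
  rw [eq_div_iff (by positivity), pow_two, ← mul_assoc, hR, ← pow_succ,
    Nat.sub_add_cancel hpos]

end Forests

section Trees

variable {m : ℕ} {par : Fin m → Fin m} {r : Fin m}

/-- The descendants of `v` (including `v`) in the tree with parent map `par`. -/
noncomputable def desc (par : Fin m → Fin m) (v : Fin m) : Finset (Fin m) :=
  univ.filter (fun w => ∃ k : ℕ, par^[k] w = v)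

theorem mem_desc {v w : Fin m} : w ∈ desc par v ↔ ∃ k : ℕ, par^[k] w = v := by
  simp [desc]

theorem self_mem_desc (v : Fin m) : v ∈ desc par v := mem_desc.2 ⟨0, rfl⟩

theorem subSize_eq_card_desc (v : Fin m) : subSize par v = (desc par v).card := by
  rw [subSize, ← Set.ncard_coe_finset]
  congr 1
  ext w
  simp [mem_desc]

theorem one_le_subSize (v : Fin m) : 1 ≤ subSize par v := by
  rw [subSize_eq_card_desc]
  exact card_pos.2 ⟨v, self_mem_desc v⟩

theorem mem_desc_of_par {v x : Fin m} (h : par x ∈ desc par v) : x ∈ desc par v := by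
  obtain ⟨k, hk⟩ := mem_desc.1 h
  exact mem_desc.2 ⟨k + 1, hk⟩

theorem par_mem_desc {v x : Fin m} (h : x ∈ desc par v) (hx : x ≠ v) : par x ∈ desc par v := by
  obtain ⟨k, hk⟩ := mem_desc.1 h
  rcases k with _ | k
  · exact absurd hk hx
  · exact mem_desc.2 ⟨k, hk⟩

theorem IsPTree.iterate_root (h : IsPTree par r) (k : ℕ) : par^[k] r = r :=
  Function.iterate_fixed h.1 k

theorem IsPTree.eq_root_of_cycle (h : IsPTree par r) {x : Fin m} {n : ℕ}
    (hx : par^[n + 1] x = x) : x = r := by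
  obtain ⟨k, hk⟩ := h.2 x
  have h1 : (par^[n + 1])^[k] x = x := Function.iterate_fixed hx k
  rw [← Function.iterate_mul, Nat.succ_mul, Function.iterate_add_apply, hk,
    h.iterate_root] at h1
  exact h1.symm

theorem IsPTree.root_notMem_desc (h : IsPTree par r) {v : Fin m} (hv : v ≠ r) :
    r ∉ desc par v := by
  intro hr
  obtain ⟨k, hk⟩ := mem_desc.1 hr
  rw [h.iterate_root] at hk
  exact hv hk.symm

theorem IsPTree.par_notMem_desc (h : IsPTree par r) {v : Fin m} (hv : v ≠ r) :
    par v ∉ desc par v := by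
  intro hr
  obtain ⟨k, hk⟩ := mem_desc.1 hr
  exact hv (h.eq_root_of_cycle (n := k) hk)

theorem IsPTree.disjoint_desc (h : IsPTree par r) {v w : Fin m} (hv : v ≠ r) (hw : w ≠ r)
    (hvw : v ≠ w) (hs : par v = par w) : Disjoint (desc par v) (desc par w) := by
  have key : ∀ (a b : ℕ) (z v w : Fin m), w ≠ r → v ≠ w → par v = par w →
      par^[a] z = v → par^[b] z = w → a ≤ b → False := by
    intro a b z v w hw hvw hs ha hb hab
    obtain ⟨c, rfl⟩ := Nat.exists_eq_add_of_le' hab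
    rw [Function.iterate_add_apply, ha] at hb
    rcases c with _ | c
    · exact hvw hb
    · rw [Function.iterate_succ_apply, hs] at hb
      exact h.par_notMem_desc hw (mem_desc.2 ⟨c, hb⟩)
  rw [disjoint_left]
  intro z hz hz'
  obtain ⟨a, ha⟩ := mem_desc.1 hz
  obtain ⟨b, hb⟩ := mem_desc.1 hz'
  rcases le_total a b with hab | hab
  · exact key a b z v w hw hvw hs ha hb hab
  · exact key b a z w v hv hvw.symm hs.symm hb ha hab

/-- The restriction of a parent map to the vertex set `S` rooted at `v`. -/
def cut (S : Finset (Fin m)) (v : Fin m) (par : Fin m → Fin m) : Fin m → Fin m :=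
  fun x => if x ∈ S.erase v then par x else x

theorem cut_mem_forests {S : Finset (Fin m)} {v : Fin m}
    (hcl : ∀ x ∈ S, x ≠ v → par x ∈ S) (hreach : ∀ x ∈ S, ∃ k : ℕ, par^[k] x = v) :
    cut S v par ∈ forests {v} (S.erase v) := by
  rw [mem_forests]
  refine ⟨fun x hx => by simp only [cut, hx, if_false], fun x hx => ?_, fun x hx => ?_⟩
  · have h := mem_erase.1 hx
    have := hcl x h.2 h.1
    simp only [cut, hx, if_true, mem_union, mem_singleton, mem_erase]
    tauto
  · have key : ∀ k : ℕ, ∀ x ∈ S, par^[k] x = v → ∃ l : ℕ, (cut S v par)^[l] x = v := by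
      intro k
      induction k with
      | zero => exact fun x _ h => ⟨0, h⟩
      | succ k ih =>
        intro x hx h
        by_cases hxv : x = v
        · exact ⟨0, hxv⟩
        · obtain ⟨l, hl⟩ := ih (par x) (hcl x hx hxv) h
          refine ⟨l + 1, ?_⟩
          rw [Function.iterate_succ_apply]
          simpa only [cut, mem_erase, hxv, hx, ne_eq, not_false_eq_true, and_self, if_true]
            using hl
    have h := mem_erase.1 hx
    obtain ⟨k, hk⟩ := hreach x h.2
    simpa using key k x h.2 hk

theorem mem_treeFinset : par ∈ treeFinset m r ↔ IsPTree par r := by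
  simp [treeFinset]

theorem treeFinset_eq_forests : treeFinset m r = forests {r} (univ.erase r) := by
  ext par
  rw [mem_treeFinset, mem_forests]
  constructor
  · intro h
    refine ⟨?_, ?_, fun x _ => by simpa using h.2 x⟩
    · intro x hx
      have : x = r := by simpa using hx
      rw [this]; exact h.1
    · intro x _
      simp only [mem_union, mem_singleton, mem_erase, mem_univ, and_true]
      tauto
  · rintro ⟨h1, -, h3⟩
    refine ⟨h1 r (by simp), fun x => ?_⟩
    by_cases hx : x = r
    · exact ⟨0, hx⟩
    · simpa using h3 x (by simp [hx])

theorem card_treeFinset : ((treeFinset m r).card : ℝ) = (m : ℝ) ^ m / (m : ℝ) ^ 2 := by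
  rw [treeFinset_eq_forests, card_forests_singleton (mem_univ r), card_univ, Fintype.card_fin]

/-- Trees in which `v` and `w` are distinct siblings with prescribed sets of descendants are
encoded by the two subtrees, the remaining tree, and the common parent. -/
theorem card_siblings_le {S₁ S₂ : Finset (Fin m)} {v w : Fin m} (hv : v ≠ r) (hw : w ≠ r) :
    ((treeFinset m r).filter (fun par => par v = par w ∧ desc par v = S₁ ∧
        desc par w = S₂)).card
      ≤ (forests {v} (S₁.erase v)).card * ((forests {w} (S₂.erase w)).card *
        ((forests {r} (((univ \ S₁) \ S₂).erase r)).card * ((univ \ S₁) \ S₂).card)) := by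
  rw [← card_product, ← card_product, ← card_product]
  refine card_le_card_of_injOn
    (fun par => (cut S₁ v par, cut S₂ w par, cut ((univ \ S₁) \ S₂) r par, par v)) ?_ ?_
  · intro par hpar
    obtain ⟨ht, hs, rfl, rfl⟩ := mem_filter.1 hpar
    have ht := mem_treeFinset.1 ht
    refine mem_product.2 ⟨?_, mem_product.2 ⟨?_, mem_product.2 ⟨?_, ?_⟩⟩⟩
    · exact cut_mem_forests (fun x hx => par_mem_desc hx)
        (fun x hx => mem_desc.1 hx)
    · exact cut_mem_forests (fun x hx => par_mem_desc hx)
        (fun x hx => mem_desc.1 hx)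
    · refine cut_mem_forests (fun x hx _ => ?_) (fun x _ => ht.2 x)
      simp only [mem_sdiff, mem_univ, true_and] at hx ⊢
      exact ⟨fun h => hx.1 (mem_desc_of_par h), fun h => hx.2 (mem_desc_of_par h)⟩
    · have h1 := ht.par_notMem_desc hv
      have h2 := ht.par_notMem_desc hw
      rw [← hs] at h2
      simp [h1, h2]
  · intro f hf g hg hfg
    obtain ⟨htf, hsf, -, -⟩ := mem_filter.1 hf
    obtain ⟨htg, hsg, -, -⟩ := mem_filter.1 hg
    simp only [Prod.mk.injEq] at hfg
    obtain ⟨h1, h2, h3, h4⟩ := hfg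
    funext x
    by_cases hxv : x = v
    · rw [hxv, h4]
    by_cases hxw : x = w
    · rw [hxw, ← hsf, ← hsg, h4]
    by_cases hxr : x = r
    · rw [hxr, (mem_treeFinset.1 htf).1, (mem_treeFinset.1 htg).1]
    have e1 := congrFun h1 x
    have e2 := congrFun h2 x
    have e3 := congrFun h3 x
    simp only [cut, mem_erase, mem_sdiff, mem_univ, true_and, hxv, hxw, hxr, ne_eq,
      not_false_eq_true] at e1 e2 e3
    by_cases hx1 : x ∈ S₁
    · simpa [hx1] using e1
    by_cases hx2 : x ∈ S₂
    · simpa [hx2] using e2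
    simpa [hx1, hx2] using e3

/-- The sum of the sizes of the subtrees rooted at `w`, over the pairs `(v, w)` of distinct
siblings such that the subtree rooted at `v` has size at least `k`. -/
noncomputable def siblingSum (r : Fin m) (k : ℕ) (par : Fin m → Fin m) : ℝ :=
  ∑ v : Fin m, ∑ w : Fin m,
    if v ≠ r ∧ w ≠ r ∧ v ≠ w ∧ par v = par w ∧ k ≤ (desc par v).card
      then ((desc par w).card : ℝ) else 0

/-- The contribution to `siblingSum` of the trees in which two given vertices are siblings whose
sets of descendants are two given sets, of sizes `a` and `b`. -/
noncomputable def siblingWeight (m k a b : ℕ) : ℝ :=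
  if k ≤ a then b * ((a : ℝ) ^ a / (a : ℝ) ^ 2 * ((b : ℝ) ^ b / (b : ℝ) ^ 2 *
    (((m - a - b : ℕ) : ℝ) ^ (m - a - b) / ((m - a - b : ℕ) : ℝ) ^ 2 * (m - a - b : ℕ)))) else 0

theorem siblingWeight_nonneg (m k a b : ℕ) : 0 ≤ siblingWeight m k a b := by
  unfold siblingWeight
  split_ifs <;> positivity

theorem sum_siblings_le (v w : Fin m) (k : ℕ) :
    ∑ par ∈ treeFinset m r,
        (if v ≠ r ∧ w ≠ r ∧ v ≠ w ∧ par v = par w ∧ k ≤ (desc par v).card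
          then ((desc par w).card : ℝ) else 0)
      ≤ ∑ x ∈ ((univ.erase r).powerset).sigma
          (fun S₁ : Finset (Fin m) => ((univ.erase r) \ S₁).powerset),
        (if v ∈ x.1 then 1 else 0) * ((if w ∈ x.2 then 1 else 0) *
          siblingWeight m k x.1.card x.2.card) := by
  by_cases hne : v ≠ r ∧ w ≠ r ∧ v ≠ w
  swap
  · have h0 : ∀ par : Fin m → Fin m,
        ¬ (v ≠ r ∧ w ≠ r ∧ v ≠ w ∧ par v = par w ∧ k ≤ (desc par v).card) := by tauto
    simp only [h0, if_false, sum_const_zero]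
    refine sum_nonneg fun x _ => ?_
    have := siblingWeight_nonneg m k x.1.card x.2.card
    positivity
  obtain ⟨hv, hw, hvw⟩ := hne
  rw [← sum_filter, ← sum_fiberwise_of_maps_to
    (g := fun par => (⟨desc par v, desc par w⟩ : (_ : Finset (Fin m)) × Finset (Fin m)))
    (t := ((univ.erase r).powerset).sigma
          (fun S₁ : Finset (Fin m) => ((univ.erase r) \ S₁).powerset))]
  swap
  · intro par hpar
    obtain ⟨ht, -, -, -, hs, -⟩ := mem_filter.1 hpar
    have ht := mem_treeFinset.1 ht
    simp only [mem_sigma, mem_powerset, subset_iff, mem_erase, mem_univ, and_true, mem_sdiff]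
    exact ⟨fun x hx h => ht.root_notMem_desc hv (h ▸ hx),
      fun x hx => ⟨fun h => ht.root_notMem_desc hw (h ▸ hx),
        fun h => disjoint_left.1 (ht.disjoint_desc hv hw hvw hs) h hx⟩⟩
  refine sum_le_sum fun x hx => ?_
  obtain ⟨S₁, S₂⟩ := x
  simp only [mem_sigma, mem_powerset] at hx
  by_cases hcond : v ∈ S₁ ∧ w ∈ S₂ ∧ k ≤ S₁.card
  · obtain ⟨h1, h2, h3⟩ := hcond
    have hr1 : r ∉ S₁ := fun h => by simpa using hx.1 h
    have hr2 : r ∉ S₂ := fun h => by simpa using hx.2 h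
    have hcard : ((univ \ S₁) \ S₂).card = m - S₁.card - S₂.card := by
      rw [card_sdiff_of_subset, card_sdiff_of_subset (subset_univ _), card_univ,
        Fintype.card_fin]
      exact fun y hy => by simpa using (mem_sdiff.1 (hx.2 hy)).2
    have hle := card_siblings_le (S₁ := S₁) (S₂ := S₂) hv hw
    have hle' : (((treeFinset m r).filter (fun par => par v = par w ∧ desc par v = S₁ ∧
        desc par w = S₂)).card : ℝ) ≤ _ := Nat.cast_le.2 hle
    push_cast at hle'
    rw [card_forests_singleton h1, card_forests_singleton h2,
      card_forests_singleton (by simp [hr1, hr2]), hcard] at hle'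
    simp only [h1, h2, if_true, one_mul, siblingWeight, h3]
    refine le_trans (le_of_eq ?_) (mul_le_mul_of_nonneg_left hle' (Nat.cast_nonneg _))
    rw [filter_filter, mul_comm, ← nsmul_eq_mul, ← sum_const]
    refine sum_congr ?_ ?_
    · ext par
      simp only [mem_filter, Sigma.mk.injEq, heq_eq_eq]
      constructor
      · tauto
      · rintro ⟨ht, hs, rfl, rfl⟩
        tauto
    · intro par hpar
      rw [(mem_filter.1 hpar).2.2.2]
  · rw [filter_filter, sum_eq_zero]
    · have := siblingWeight_nonneg m k S₁.card S₂.card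
      positivity
    · intro par hpar
      obtain ⟨-, ⟨-, -, -, -, hk⟩, he⟩ := mem_filter.1 hpar
      simp only [Sigma.mk.injEq, heq_eq_eq] at he
      obtain ⟨rfl, rfl⟩ := he
      exact absurd ⟨self_mem_desc v, self_mem_desc w, hk⟩ hcond

theorem sum_siblingSum_le (r : Fin m) (k : ℕ) :
    ∑ par ∈ treeFinset m r, siblingSum r k par
      ≤ ∑ S₁ ∈ (univ.erase r).powerset, ∑ S₂ ∈ ((univ.erase r) \ S₁).powerset,
          (S₁.card : ℝ) * (S₂.card * siblingWeight m k S₁.card S₂.card) := by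
  have h1 : ∑ par ∈ treeFinset m r, siblingSum r k par
      ≤ ∑ v : Fin m, ∑ w : Fin m, ∑ x ∈ ((univ.erase r).powerset).sigma
          (fun S₁ : Finset (Fin m) => ((univ.erase r) \ S₁).powerset),
        (if v ∈ x.1 then 1 else 0) * ((if w ∈ x.2 then 1 else 0) *
          siblingWeight m k x.1.card x.2.card) := by
    unfold siblingSum
    rw [sum_comm]
    refine sum_le_sum fun v _ => ?_
    rw [sum_comm]
    exact sum_le_sum fun w _ => sum_siblings_le v w k
  refine h1.trans (le_of_eq (Eq.trans ?_ (sum_sigma' _ _ _).symm))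
  rw [sum_congr rfl fun v _ => sum_comm, sum_comm]
  refine sum_congr rfl fun x _ => ?_
  rw [sum_congr rfl fun v _ => (mul_sum _ _ _).symm, ← sum_mul, ← sum_mul]
  simp

end Trees

theorem findIdx_le_of_sublist {α : Type*} [DecidableEq α] {v u : α} (hvu : v ≠ u) :
    ∀ {L : List α}, L.Nodup → [v, u].Sublist L →
      L.findIdx (fun w => decide (w = v)) ≤ L.findIdx (fun w => decide (w = u))
  | [], _, h => by simp
  | a :: L, hn, h => by
    rw [List.nodup_cons] at hn
    by_cases hav : a = v
    · simp [List.findIdx_cons, hav]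
    · have hL : [v, u].Sublist L := by
        rcases List.sublist_cons_iff.1 h with h | ⟨l, hl, -⟩
        · exact h
        · exact absurd (List.cons.inj hl).1.symm hav
      have hau : a ≠ u := by
        rintro rfl
        exact hn.1 (hL.subset (by simp))
      simpa [List.findIdx_cons, hav, hau] using findIdx_le_of_sublist hvu hn.2 hL

section Exploration

variable {m : ℕ} {par : Fin m → Fin m} {r : Fin m} {adj : Fin m → Fin m → Bool}

theorem step_nil {s : St m} (h : s.stack = []) : step adj s = s := by
  simp [step, h]

theorem step_cons {s : St m} {v : Fin m} {rest : List (Fin m)} (h : s.stack = v :: rest) :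
    (step adj s).visited = s.visited ++ [v] ∧
    ((step adj s).stack = (List.finRange m).filter
        (fun w => adj v w && !(decide (w ∈ s.stack)) && !(decide (w ∈ s.visited))) ++ rest ∨
      rest = [] ∧ (step adj s).stack =
        ((List.finRange m).filter (fun w => !(decide (w ∈ s.visited ++ [v])))).take 1) := by
  obtain ⟨stack, visited⟩ := s
  simp only at h
  subst h
  simp only [step]
  refine ⟨trivial, ?_⟩
  split_ifs with h1
  · right
    rw [List.isEmpty_iff, List.append_eq_nil_iff] at h1
    exact ⟨h1.2, rfl⟩
  · exact Or.inl rfl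

theorem sublist_step (s : St m) :
    (s.visited ++ s.stack).Sublist ((step adj s).visited ++ (step adj s).stack) := by
  rcases hs : s.stack with _ | ⟨v, rest⟩
  · rw [step_nil hs, hs]
  · obtain ⟨h1, h2⟩ := step_cons (adj := adj) hs
    rw [h1, List.append_assoc]
    refine List.Sublist.append_left ?_ _
    rw [List.singleton_append, List.cons_sublist_cons]
    rcases h2 with h2 | ⟨h2, -⟩
    · rw [h2]; exact List.sublist_append_right _ _
    · rw [h2]; exact List.nil_sublist _

theorem nodup_step {s : St m} (hn : (s.visited ++ s.stack).Nodup) :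
    ((step adj s).visited ++ (step adj s).stack).Nodup := by
  rcases hs : s.stack with _ | ⟨v, rest⟩
  · rwa [step_nil hs]
  · obtain ⟨h1, h2⟩ := step_cons (adj := adj) hs
    rw [h1]
    rcases h2 with h2 | ⟨-, h2⟩
    · rw [h2, ← List.append_assoc]
      have hf : ((List.finRange m).filter
          (fun w => adj v w && !(decide (w ∈ s.stack)) && !(decide (w ∈ s.visited)))).Nodup :=
        (List.nodup_finRange m).filter _
      rw [hs] at hn hf ⊢
      simp only [List.nodup_append, List.mem_append, List.mem_filter, List.nodup_cons,
        List.mem_cons] at hn hf ⊢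
      simp only [Bool.and_eq_true, Bool.not_eq_true', decide_eq_false_iff_not]
      grind
    · rw [h2]
      refine List.nodup_append'.2 ⟨?_, ?_, ?_⟩
      · rw [hs] at hn
        exact hn.sublist (List.Sublist.append_left (by simp) _)
      · exact ((List.nodup_finRange m).filter _).sublist (List.take_sublist _ _)
      · intro x hx hx'
        have := List.mem_of_mem_take hx'
        simp only [List.mem_filter, Bool.not_eq_true', decide_eq_false_iff_not] at this
        exact this.2 hx

theorem stateAt_succ (i : ℕ) : stateAt adj r (i + 1) = step adj (stateAt adj r i) :=
  Function.iterate_succ_apply' _ _ _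

theorem nodup_stateAt (i : ℕ) :
    ((stateAt adj r i).visited ++ (stateAt adj r i).stack).Nodup := by
  induction i with
  | zero => simp [stateAt]
  | succ i ih => rw [stateAt_succ]; exact nodup_step ih

theorem sublist_stateAt {i j : ℕ} (hij : i ≤ j) :
    ((stateAt adj r i).visited ++ (stateAt adj r i).stack).Sublist
      ((stateAt adj r j).visited ++ (stateAt adj r j).stack) := by
  induction hij with
  | refl => exact List.Sublist.refl _
  | step _ ih => rw [stateAt_succ]; exact ih.trans (sublist_step _)

/-- `y` is a non-root vertex having a sibling which is an ancestor of `x` (possibly `x`). -/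
def SiblingOfAncestor (par : Fin m → Fin m) (r x y : Fin m) : Prop :=
  ∃ w, w ≠ r ∧ y ≠ r ∧ w ≠ y ∧ par w = par y ∧ x ∈ desc par w

theorem pairwise_step {s : St m} (h : s.stack.Pairwise (SiblingOfAncestor par r)) :
    (step (childAdj par r) s).stack.Pairwise (SiblingOfAncestor par r) := by
  rcases hs : s.stack with _ | ⟨v, rest⟩
  · rwa [step_nil hs]
  · rw [hs, List.pairwise_cons] at h
    rcases (step_cons (adj := childAdj par r) hs).2 with h2 | ⟨-, h2⟩
    · rw [h2, List.pairwise_append]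
      have hc : ∀ c ∈ (List.finRange m).filter (fun w => childAdj par r v w &&
          !(decide (w ∈ s.stack)) && !(decide (w ∈ s.visited))), c ≠ r ∧ par c = v := by
        intro c hc
        simp only [List.mem_filter, childAdj, Bool.and_eq_true, decide_eq_true_eq] at hc
        exact hc.2.1.1
      refine ⟨?_, h.2, ?_⟩
      · refine List.Pairwise.imp_of_mem ?_ ((List.nodup_finRange m).filter _)
        intro a b ha hb hab
        exact ⟨a, (hc a ha).1, (hc b hb).1, hab, (hc a ha).2.trans (hc b hb).2.symm,
          self_mem_desc a⟩
      · intro c hcm y hy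
        obtain ⟨w, h1, h2, h3, h4, h5⟩ := h.1 y hy
        exact ⟨w, h1, h2, h3, h4, mem_desc_of_par ((hc c hcm).2 ▸ h5)⟩
    · rw [h2]
      rcases (List.finRange m).filter (fun w => !(decide (w ∈ s.visited ++ [v]))) with _ | ⟨a, l⟩
      · simp
      · simp

theorem pairwise_stateAt (i : ℕ) :
    (stateAt (childAdj par r) r i).stack.Pairwise (SiblingOfAncestor par r) := by
  induction i with
  | zero => simp [stateAt]
  | succ i ih => rw [stateAt_succ]; exact pairwise_step ih

theorem siblingOfAncestor_of_mem_permitted {x : Fin m × Fin m} (hx : x ∈ permitted par r) :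
    SiblingOfAncestor par r x.1 x.2 := by
  obtain ⟨u, v⟩ := x
  simp only [permitted, mem_filter, mem_univ, true_and] at hx
  obtain ⟨hne, hpos, i, hi, hu, hv⟩ := hx
  have hsub := sublist_stateAt (adj := childAdj par r) (r := r) hi
  have hnd := nodup_stateAt (adj := childAdj par r) (r := r) m
  obtain ⟨a, b, hab⟩ := List.append_of_mem hu
  have hv' := hv
  rw [hab, List.mem_append, List.mem_cons] at hv'
  have hpw := pairwise_stateAt (par := par) (r := r) i
  rw [hab, List.pairwise_append, List.pairwise_cons] at hpw
  rcases hv' with hva | rfl | hvb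
  · exfalso
    have hvu : [v, u].Sublist (stateAt (childAdj par r) r i).stack := by
      rw [hab]
      exact (List.singleton_sublist.2 hva).append (List.singleton_sublist.2 (by simp))
    have h3 := (hvu.trans (List.sublist_append_right _ _)).trans hsub
    simp only [dfsPos, dfsOrder] at hpos
    have hu' : u ∈ (stateAt (childAdj par r) r m).visited := by
      by_contra hu'
      refine absurd hpos (not_lt.2 ?_)
      rw [List.findIdx_eq_length_of_false (p := fun w => decide (w = u))
        (fun w hw => decide_eq_false (fun h => hu' (h ▸ hw)))]
      exact List.findIdx_le_length
    have hu'' : u ∉ (stateAt (childAdj par r) r m).stack :=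
      fun h => (List.nodup_append'.1 hnd).2.2 hu' h
    obtain ⟨l₁, l₂, hl, hl₁, hl₂⟩ := List.sublist_append_iff.1 h3
    rcases l₂ with _ | ⟨c, l₂⟩
    · rw [List.append_nil] at hl
      subst hl
      exact absurd hpos (not_lt.2 (findIdx_le_of_sublist (Ne.symm hne)
        (List.nodup_append'.1 hnd).1 hl₁))
    · have hlast : u ∈ c :: l₂ := by
        have h5 := congrArg List.getLast? hl
        rw [List.getLast?_append_cons] at h5
        exact List.mem_of_getLast? (by rw [← h5]; rfl)
      exact hu'' (hl₂.subset hlast)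
  · exact absurd rfl hne
  · exact hpw.2.1.1 v hvb

end Exploration

section Estimates

open Real

theorem pow_self_le_factorial {x : ℕ} (hx : 1 ≤ x) :
    (x : ℝ) ^ x * √x ≤ (x.factorial : ℝ) * exp x := by
  have h := Stirling.le_factorial_stirling x
  have h1 : √(x : ℝ) ≤ √(2 * π * x) := by
    apply sqrt_le_sqrt
    have : (1 : ℝ) ≤ 2 * π := by linarith [pi_gt_three]
    have hx' : (0 : ℝ) ≤ x := Nat.cast_nonneg x
    nlinarith
  have h2 : √(x : ℝ) * (x / exp 1) ^ x ≤ x.factorial :=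
    (mul_le_mul_of_nonneg_right h1 (by positivity)).trans h
  rw [div_pow, ← exp_nat_mul, mul_one, ← mul_div_assoc, div_le_iff₀ (exp_pos _)] at h2
  linarith

theorem factorial_le_pow_self {x : ℕ} (hx : 1 ≤ x) :
    (x.factorial : ℝ) * exp x ≤ exp 1 * √x * (x : ℝ) ^ x := by
  obtain ⟨n, rfl⟩ := Nat.exists_eq_add_of_le' hx
  have h : Stirling.stirlingSeq (n + 1) ≤ Stirling.stirlingSeq 1 :=
    Stirling.stirlingSeq'_antitone (Nat.zero_le n)
  have hpos : (0 : ℝ) < ((n + 1 : ℕ) : ℝ) := by positivity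
  rw [Stirling.stirlingSeq_one, Stirling.stirlingSeq,
    div_le_iff₀ (by positivity), div_pow, ← exp_nat_mul, mul_one,
    sqrt_mul (by norm_num)] at h
  have h2 : exp 1 / √2 * (√2 * √((n + 1 : ℕ) : ℝ) *
      (((n + 1 : ℕ) : ℝ) ^ (n + 1) / exp ((n + 1 : ℕ) : ℝ))) =
      exp 1 * √((n + 1 : ℕ) : ℝ) * ((n + 1 : ℕ) : ℝ) ^ (n + 1) / exp ((n + 1 : ℕ) : ℝ) := by
    field_simp
  rw [h2, le_div_iff₀ (exp_pos _)] at h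
  exact h

theorem sum_inv_sqrt_le (s : ℕ) : ∑ j ∈ Icc 1 s, 1 / √(j : ℝ) ≤ 2 * √(s : ℝ) := by
  induction s with
  | zero => simp
  | succ s ih =>
    rw [sum_Icc_succ_top (by omega)]
    have ha : (0 : ℝ) ≤ √(s : ℝ) := sqrt_nonneg _
    have hb : 0 < √((s + 1 : ℕ) : ℝ) := sqrt_pos.2 (by positivity)
    have ha2 : √(s : ℝ) ^ 2 = s := sq_sqrt (Nat.cast_nonneg _)
    have hb2 : √((s + 1 : ℕ) : ℝ) ^ 2 = s + 1 := by rw [sq_sqrt (by positivity)]; push_cast; ring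
    have : 1 / √((s + 1 : ℕ) : ℝ) ≤ 2 * √((s + 1 : ℕ) : ℝ) - 2 * √(s : ℝ) := by
      rw [div_le_iff₀ hb]
      nlinarith [sq_nonneg (√((s + 1 : ℕ) : ℝ) - √(s : ℝ))]
    linarith

theorem inv_sqrt_mul_le {a b : ℝ} (ha : 0 < a) (hb : 0 < b) :
    1 / (√a * √b) ≤ 2 / √(a + b) * (1 / √a + 1 / √b) := by
  have hA := sqrt_pos.2 ha
  have hB := sqrt_pos.2 hb
  have hab : √(a + b) ≤ √a + √b := by
    rw [sqrt_le_left (by positivity)]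
    nlinarith [sq_sqrt ha.le, sq_sqrt hb.le, mul_pos hA hB]
  have hS : 0 < √(a + b) := sqrt_pos.2 (by linarith)
  have : 2 / √(a + b) * (1 / √a + 1 / √b) = 2 * (√a + √b) / √(a + b) * (1 / (√a * √b)) := by
    field_simp
    ring
  rw [this]
  refine le_mul_of_one_le_left (by positivity) ?_
  rw [le_div_iff₀ hS]
  linarith

theorem sum_inv_sqrt_mul_le (s : ℕ) :
    ∑ j ∈ Ico 1 s, 1 / (√(j : ℝ) * √((s - j : ℕ) : ℝ)) ≤ 8 := by
  rcases Nat.eq_zero_or_pos s with rfl | hs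
  · simp
  have hS : 0 < √(s : ℝ) := sqrt_pos.2 (by exact_mod_cast hs)
  have hle : ∑ j ∈ Ico 1 s, 1 / √(j : ℝ) ≤ 2 * √(s : ℝ) :=
    (sum_le_sum_of_subset_of_nonneg (fun j hj => by simp at hj ⊢; omega)
      (fun _ _ _ => by positivity)).trans (sum_inv_sqrt_le s)
  have hrefl : ∑ j ∈ Ico 1 s, 1 / √((s - j : ℕ) : ℝ) = ∑ j ∈ Ico 1 s, 1 / √(j : ℝ) := by
    refine sum_nbij' (fun j => s - j) (fun j => s - j) ?_ ?_ ?_ ?_ ?_ <;>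
      intro j hj <;> simp at hj ⊢ <;> omega
  calc ∑ j ∈ Ico 1 s, 1 / (√(j : ℝ) * √((s - j : ℕ) : ℝ))
      ≤ ∑ j ∈ Ico 1 s, 2 / √(s : ℝ) * (1 / √(j : ℝ) + 1 / √((s - j : ℕ) : ℝ)) := by
        refine sum_le_sum fun j hj => ?_
        rw [mem_Ico] at hj
        have h := inv_sqrt_mul_le (a := j) (b := ((s - j : ℕ) : ℝ))
          (by exact_mod_cast hj.1) (by exact_mod_cast Nat.sub_pos_of_lt hj.2)
        rwa [← Nat.cast_add, Nat.add_sub_cancel' hj.2.le] at h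
    _ = 2 / √(s : ℝ) * (2 * ∑ j ∈ Ico 1 s, 1 / √(j : ℝ)) := by
        rw [← mul_sum, sum_add_distrib, hrefl]; ring
    _ ≤ 2 / √(s : ℝ) * (2 * (2 * √(s : ℝ))) := by gcongr
    _ = 8 := by field_simp; norm_num

theorem sum_inv_mul_sqrt_le {k : ℕ} (hk : 1 ≤ k) (n : ℕ) :
    ∑ a ∈ Ico k n, 1 / ((a : ℝ) * √(a : ℝ)) ≤ 6 / √(k : ℝ) := by
  have key : ∀ n, k ≤ n → ∑ a ∈ Ico k n, 1 / ((a : ℝ) * √(a : ℝ)) ≤ 6 / √(k : ℝ) - 6 / √(n : ℝ) := by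
    intro n hn
    induction n, hn using Nat.le_induction with
    | base => simp
    | succ n hn ih =>
      rw [sum_Ico_succ_top hn]
      have hn1 : (1 : ℝ) ≤ n := by exact_mod_cast hk.trans hn
      have ha : 0 < √(n : ℝ) := sqrt_pos.2 (by linarith)
      have hb : 0 < √((n + 1 : ℕ) : ℝ) := sqrt_pos.2 (by positivity)
      have ha2 : √(n : ℝ) ^ 2 = n := sq_sqrt (Nat.cast_nonneg _)
      have hb2 : √((n + 1 : ℕ) : ℝ) ^ 2 = n + 1 := by
        rw [sq_sqrt (by positivity)]; push_cast; ring
      have : 1 / ((n : ℝ) * √(n : ℝ)) ≤ 6 / √(n : ℝ) - 6 / √((n + 1 : ℕ) : ℝ) := by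
        set x := √(n : ℝ)
        set y := √((n + 1 : ℕ) : ℝ)
        rw [← ha2, div_sub_div _ _ ha.ne' hb.ne', div_le_div_iff₀ (by positivity) (by positivity)]
        have hxy : x ≤ y := by nlinarith
        have hy2 : y ≤ 3 / 2 * x := by nlinarith
        have h1 : (y - x) * (y + x) = 1 := by nlinarith
        have h2 : 6 * (y - x) * (x * x) * (y + x) ≥ y * (y + x) := by
          have : 6 * (y - x) * (x * x) * (y + x) = 6 * (x * x) := by
            linear_combination (6 * x * x) * h1
          rw [this]
          nlinarith
        have h3 : y ≤ 6 * (y - x) * (x * x) := le_of_mul_le_mul_right h2 (by positivity)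
        nlinarith
      linarith
  rcases le_or_gt k n with h | h
  · exact (key n h).trans (by have : 0 ≤ 6 / √(n : ℝ) := by positivity
                              linarith)
  · rw [Ico_eq_empty (by omega)]; simp only [sum_empty]; positivity

end Estimates

section Counting

open Real

theorem choose_mul_siblingWeight_le {m k a b : ℕ} (ha : 1 ≤ a) (hb : 1 ≤ b) (hab : a + b < m) :
    ((m - 1).choose a : ℝ) * (((m - 1 - a).choose b : ℝ) *
        ((a : ℝ) * (b * siblingWeight m k a b)))
      ≤ exp 1 * √(m : ℝ) * (m : ℝ) ^ m / m *
        (1 / ((a : ℝ) * √(a : ℝ)) * (1 / (√(b : ℝ) * √((m - a - b : ℕ) : ℝ)))) := by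
  obtain ⟨n, rfl⟩ : ∃ n, m = a + b + (n + 1) := ⟨m - a - b - 1, by omega⟩
  have e1 : a + b + (n + 1) - 1 = a + (b + n) := by omega
  have e2 : a + (b + n) - a = b + n := by omega
  have e3 : a + b + (n + 1) - a - b = n + 1 := by omega
  unfold siblingWeight
  rw [e1, e2, e3]
  split_ifs with hk
  swap
  · simp only [mul_zero]; positivity
  have hc1 : ((a + (b + n)).choose a : ℝ)
      = (a + (b + n)).factorial / (a.factorial * (b + n).factorial) := by
    rw [Nat.cast_choose ℝ (Nat.le_add_right _ _), Nat.add_sub_cancel_left]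
  have hc2 : ((b + n).choose b : ℝ)
      = (b + n).factorial / (b.factorial * n.factorial) := by
    rw [Nat.cast_choose ℝ (Nat.le_add_right _ _), Nat.add_sub_cancel_left]
  have ha0 : (0 : ℝ) < a := by exact_mod_cast ha
  have hb0 : (0 : ℝ) < b := by exact_mod_cast hb
  have hA := pow_self_le_factorial ha
  have hB := pow_self_le_factorial hb
  have hN := pow_self_le_factorial (x := n + 1) (by omega)
  have hM := factorial_le_pow_self (x := a + b + (n + 1)) (by omega)
  have hfm : ((a + b + (n + 1)).factorial : ℝ)
      = ((a + b + (n + 1) : ℕ) : ℝ) * (a + (b + n)).factorial := by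
    rw [show a + b + (n + 1) = a + (b + n) + 1 by omega, Nat.factorial_succ]; push_cast; ring
  have hfn : ((n + 1).factorial : ℝ) = ((n + 1 : ℕ) : ℝ) * n.factorial := by
    rw [Nat.factorial_succ]; push_cast; ring
  have hexp : exp ((a + b + (n + 1) : ℕ) : ℝ)
      = exp (a : ℝ) * exp (b : ℝ) * exp ((n + 1 : ℕ) : ℝ) := by
    rw [← exp_add, ← exp_add]; push_cast; ring_nf
  have hn0 : (0 : ℝ) < ((n + 1 : ℕ) : ℝ) := by positivity
  have hm0 : (0 : ℝ) < ((a + b + (n + 1) : ℕ) : ℝ) := by positivity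
  have hfa : (0 : ℝ) < a.factorial := by positivity
  have hfb : (0 : ℝ) < b.factorial := by positivity
  have hfn0 : (0 : ℝ) < n.factorial := by positivity
  have hfbn : (0 : ℝ) < (b + n).factorial := by positivity
  have hsa : 0 < √(a : ℝ) := sqrt_pos.2 ha0
  have hsb : 0 < √(b : ℝ) := sqrt_pos.2 hb0
  have hsn : 0 < √((n + 1 : ℕ) : ℝ) := sqrt_pos.2 hn0
  have hA0 : 0 ≤ (a : ℝ) ^ a := by positivity
  have hB0 : 0 ≤ (b : ℝ) ^ b := by positivity
  have hN0 : 0 ≤ ((n + 1 : ℕ) : ℝ) ^ (n + 1) := by positivity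
  have hfm0 : (0 : ℝ) < (a + (b + n)).factorial := by positivity
  rw [hc1, hc2]
  rw [hfn] at hN
  rw [hfm, hexp] at hM
  generalize ((n + 1 : ℕ) : ℝ) ^ (n + 1) = N at *
  generalize (a : ℝ) ^ a = A at *
  generalize (b : ℝ) ^ b = B at *
  generalize ((a + b + (n + 1) : ℕ) : ℝ) ^ (a + b + (n + 1)) = M at *
  generalize ((a + (b + n)).factorial : ℝ) = fm at *
  generalize ((b + n).factorial : ℝ) = fbn at *
  generalize (a.factorial : ℝ) = fa at *
  generalize (b.factorial : ℝ) = fb at *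
  generalize (n.factorial : ℝ) = fn at *
  generalize ((n + 1 : ℕ) : ℝ) = n' at *
  generalize ((a + b + (n + 1) : ℕ) : ℝ) = m' at *
  have hprod : A * √(a : ℝ) * (B * √(b : ℝ)) * (N * √n')
      ≤ fa * exp a * (fb * exp b) * (n' * fn * exp n') := by gcongr
  calc fm / (fa * fbn) * (fbn / (fb * fn) *
        (a * (b * (b * (A / a ^ 2 * (B / b ^ 2 * (N / n' ^ 2 * n')))))))
      = fm / (fa * fb * fn * n' * a * (√(a : ℝ) * √(b : ℝ) * √n')) *
          (A * √(a : ℝ) * (B * √(b : ℝ)) * (N * √n')) := by field_simp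
    _ ≤ fm / (fa * fb * fn * n' * a * (√(a : ℝ) * √(b : ℝ) * √n')) *
          (fa * exp a * (fb * exp b) * (n' * fn * exp n')) := by gcongr
    _ = m' * fm * (exp a * exp b * exp n') *
          (1 / m' * (1 / (a * √(a : ℝ)) * (1 / (√(b : ℝ) * √n')))) := by field_simp
    _ ≤ exp 1 * √m' * M * (1 / m' * (1 / (a * √(a : ℝ)) * (1 / (√(b : ℝ) * √n')))) := by
        gcongr
    _ = _ := by ring

theorem sum_siblingSum_le_card {m k : ℕ} (r : Fin m) (hk : 1 ≤ k) :
    ∑ par ∈ treeFinset m r, siblingSum r k par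
      ≤ 48 * exp 1 * ((m : ℝ) * √(m : ℝ)) / √(k : ℝ) * (treeFinset m r).card := by
  have hm : 0 < m := r.pos
  have hm0 : (0 : ℝ) < m := by exact_mod_cast hm
  have hU : (univ.erase r).card = m - 1 := by
    rw [card_erase_of_mem (mem_univ _), card_univ, Fintype.card_fin]
  refine (sum_siblingSum_le r k).trans ?_
  have h1 : ∑ S₁ ∈ (univ.erase r).powerset, ∑ S₂ ∈ ((univ.erase r) \ S₁).powerset,
          (S₁.card : ℝ) * (S₂.card * siblingWeight m k S₁.card S₂.card)
      = ∑ a ∈ range m, ∑ b ∈ range (m - a), ((m - 1).choose a : ℝ) *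
          (((m - 1 - a).choose b : ℝ) * ((a : ℝ) * (b * siblingWeight m k a b))) := by
    have h2 : ∀ S₁ ∈ (univ.erase r).powerset, ∑ S₂ ∈ ((univ.erase r) \ S₁).powerset,
          (S₁.card : ℝ) * (S₂.card * siblingWeight m k S₁.card S₂.card)
        = (fun a : ℕ => ∑ b ∈ range (m - 1 - a + 1), ((m - 1 - a).choose b : ℝ) *
          ((a : ℝ) * (b * siblingWeight m k a b))) S₁.card := by
      intro S₁ hS₁
      rw [sum_powerset_apply_card
        (fun b : ℕ => (S₁.card : ℝ) * (b * siblingWeight m k S₁.card b)),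
        card_sdiff_of_subset (mem_powerset.1 hS₁), hU]
      simp only [nsmul_eq_mul]
    refine (sum_congr rfl h2).trans ((sum_powerset_apply_card
      (fun a : ℕ => ∑ b ∈ range (m - 1 - a + 1), ((m - 1 - a).choose b : ℝ) *
        ((a : ℝ) * (b * siblingWeight m k a b)))).trans ?_)
    rw [hU, Nat.sub_add_cancel hm]
    refine sum_congr rfl fun a ha => ?_
    rw [nsmul_eq_mul, mul_sum]
    rw [mem_range] at ha
    rw [show m - 1 - a + 1 = m - a by omega]
  rw [h1]
  calc ∑ a ∈ range m, ∑ b ∈ range (m - a), ((m - 1).choose a : ℝ) *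
          (((m - 1 - a).choose b : ℝ) * ((a : ℝ) * (b * siblingWeight m k a b)))
      = ∑ a ∈ Ico k m, ∑ b ∈ Ico 1 (m - a), ((m - 1).choose a : ℝ) *
          (((m - 1 - a).choose b : ℝ) * ((a : ℝ) * (b * siblingWeight m k a b))) := by
        symm
        rw [← sum_subset (s₁ := Ico k m) (s₂ := range m)]
        · refine sum_congr rfl fun a _ => ?_
          refine sum_subset (fun b hb => by simp at hb ⊢; omega) fun b hb hb' => ?_
          have : b = 0 := by simp at hb hb'; omega
          simp [this]
        · exact fun a ha => by simp at ha ⊢; omega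
        · intro a ha ha'
          have : ¬ k ≤ a := by simp at ha ha'; omega
          simp [siblingWeight, this]
    _ ≤ ∑ a ∈ Ico k m, ∑ b ∈ Ico 1 (m - a), exp 1 * √(m : ℝ) * (m : ℝ) ^ m / m *
        (1 / ((a : ℝ) * √(a : ℝ)) * (1 / (√(b : ℝ) * √((m - a - b : ℕ) : ℝ)))) := by
        refine sum_le_sum fun a ha => sum_le_sum fun b hb => ?_
        rw [mem_Ico] at ha hb
        exact choose_mul_siblingWeight_le (by omega) (by omega) (by omega)
    _ = exp 1 * √(m : ℝ) * (m : ℝ) ^ m / m * ∑ a ∈ Ico k m, 1 / ((a : ℝ) * √(a : ℝ)) *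
          ∑ b ∈ Ico 1 (m - a), 1 / (√(b : ℝ) * √((m - a - b : ℕ) : ℝ)) := by
        simp only [mul_sum]
    _ ≤ exp 1 * √(m : ℝ) * (m : ℝ) ^ m / m * ∑ a ∈ Ico k m, 1 / ((a : ℝ) * √(a : ℝ)) * 8 := by
        gcongr with a _
        exact sum_inv_sqrt_mul_le (m - a)
    _ ≤ exp 1 * √(m : ℝ) * (m : ℝ) ^ m / m * (6 / √(k : ℝ) * 8) := by
        rw [← sum_mul]
        gcongr
        exact sum_inv_mul_sqrt_le hk m
    _ = 48 * exp 1 * ((m : ℝ) * √(m : ℝ)) / √(k : ℝ) * (treeFinset m r).card := by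
        rw [card_treeFinset]
        field_simp
        ring

variable {m : ℕ} {par : Fin m → Fin m} {r : Fin m}

theorem card_permitted_le (k : ℕ) :
    (((permitted par r).filter (fun x => k ≤ subSize par x.2)).card : ℝ)
      ≤ siblingSum r k par := by
  have h1 : siblingSum r k par = ((∑ x ∈ univ.filter (fun x : Fin m × Fin m => x.1 ≠ r ∧
      x.2 ≠ r ∧ x.1 ≠ x.2 ∧ par x.1 = par x.2 ∧ k ≤ (desc par x.1).card),
        (desc par x.2 ×ˢ {x.1}).card : ℕ) : ℝ) := by
    rw [siblingSum, sum_filter, ← Fintype.sum_prod_type'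
      (f := fun v w => if v ≠ r ∧ w ≠ r ∧ v ≠ w ∧ par v = par w ∧ k ≤ (desc par v).card
        then ((desc par w).card : ℝ) else 0)]
    push_cast
    simp
  rw [h1]
  refine Nat.cast_le.2 (le_trans (card_le_card ?_) card_biUnion_le)
  intro x hx
  obtain ⟨hx, hk⟩ := mem_filter.1 hx
  obtain ⟨w, h1, h2, h3, h4, h5⟩ := siblingOfAncestor_of_mem_permitted hx
  rw [subSize_eq_card_desc] at hk
  refine mem_biUnion.2 ⟨(x.2, w), ?_, ?_⟩
  · simp [h1, h2, h3.symm, h4, hk]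
  · simp [h5]

end Counting

section Probability

variable {m : ℕ} {par : Fin m → Fin m} {r : Fin m} {p : ℝ}

theorem surpW_nonneg (h0 : 0 ≤ p) (h1 : p ≤ 1) (s : Fin m → Fin m → Bool) :
    0 ≤ surpW p par r s := by
  unfold surpW
  split_ifs
  · refine prod_nonneg fun x _ => ?_
    split_ifs <;> linarith
  · exact le_rfl

theorem surpW_eq_prod (s : Fin m → Fin m → Bool) :
    surpW p par r s = ∏ x : Fin m × Fin m, if x ∈ permitted par r
      then (if s x.1 x.2 then p else 1 - p) else (if s x.1 x.2 then 0 else 1) := by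
  unfold surpW
  split_ifs with h
  · refine (prod_congr rfl fun x hx => (if_pos hx).symm).trans
      (prod_subset (subset_univ _) fun x _ hx => ?_)
    rw [if_neg hx, if_neg (fun hs => hx (h x.1 x.2 hs))]
  · push Not at h
    obtain ⟨u, w, hs, hn⟩ := h
    exact (prod_eq_zero (mem_univ (u, w)) (by simp [hs, hn])).symm

theorem sum_prod_bool (g : Fin m × Fin m → Bool → ℝ) :
    ∑ s : Fin m → Fin m → Bool, ∏ x : Fin m × Fin m, g x (s x.1 x.2)
      = ∏ x : Fin m × Fin m, ∑ b : Bool, g x b := by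
  rw [prod_univ_sum, Fintype.piFinset_univ, ← (Equiv.curry (Fin m) (Fin m) Bool).sum_comp]
  rfl

theorem sum_surpW_mul_indicator {x₀ : Fin m × Fin m} (hx : x₀ ∈ permitted par r) :
    ∑ s : Fin m → Fin m → Bool, surpW p par r s * (if s x₀.1 x₀.2 = true then 1 else 0) = p := by
  obtain ⟨g, hg⟩ : ∃ g : Fin m × Fin m → Bool → ℝ, g = fun x b =>
      (if x ∈ permitted par r then (if b then p else 1 - p) else (if b then 0 else 1)) *
        (if x = x₀ then (if b = true then 1 else 0) else 1) := ⟨_, rfl⟩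
  have h : ∀ s : Fin m → Fin m → Bool,
      surpW p par r s * (if s x₀.1 x₀.2 = true then 1 else 0)
        = ∏ x : Fin m × Fin m, g x (s x.1 x.2) := by
    intro s
    rw [surpW_eq_prod, hg, prod_mul_distrib]
    simp
  rw [sum_congr rfl fun s _ => h s, sum_prod_bool, prod_eq_single x₀]
  · simp [hg, hx]
  · intro x _ hne
    by_cases hxp : x ∈ permitted par r <;> simp [hg, hxp, hne]
  · simp

theorem sum_surpW_le {k K : ℕ} (hK : 0 < K) (h0 : 0 ≤ p) (h1 : p ≤ 1) :
    ∑ s : Fin m → Fin m → Bool, surpW p par r s *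
        (if K < ∑ x ∈ (permitted par r).filter (fun x => s x.1 x.2 = true),
            subSize par x.2 then 1 else 0)
      ≤ p * (siblingSum r k par + (k : ℝ) / K * siblingSum r 1 par) := by
  have hK0 : (0 : ℝ) < K := by exact_mod_cast hK
  have hpt : ∀ s : Fin m → Fin m → Bool,
      (if K < ∑ x ∈ (permitted par r).filter (fun x => s x.1 x.2 = true),
        subSize par x.2 then (1 : ℝ) else 0)
      ≤ ∑ x ∈ (permitted par r).filter (fun x => k ≤ subSize par x.2),
          (if s x.1 x.2 = true then (1 : ℝ) else 0)
        + (k : ℝ) / K * ∑ x ∈ (permitted par r).filter (fun x => 1 ≤ subSize par x.2),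
          (if s x.1 x.2 = true then (1 : ℝ) else 0) := by
    intro s
    have hnn : ∀ S : Finset (Fin m × Fin m),
        0 ≤ ∑ x ∈ S, (if s x.1 x.2 = true then (1 : ℝ) else 0) :=
      fun S => sum_nonneg fun x _ => by split_ifs <;> norm_num
    have hc : 0 ≤ (k : ℝ) / K := by positivity
    split_ifs with hlt
    swap
    · exact add_nonneg (hnn _) (mul_nonneg hc (hnn _))
    by_cases hbig : ∃ x ∈ permitted par r, k ≤ subSize par x.2 ∧ s x.1 x.2 = true
    · obtain ⟨x, hx, hkx, hsx⟩ := hbig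
      have h2 : (1 : ℝ) ≤ ∑ x ∈ (permitted par r).filter (fun x => k ≤ subSize par x.2),
          (if s x.1 x.2 = true then (1 : ℝ) else 0) := by
        refine le_trans (by simp [hsx]) (single_le_sum (f := fun x : Fin m × Fin m =>
          if s x.1 x.2 = true then (1 : ℝ) else 0) (fun y _ => by split_ifs <;> norm_num)
          (mem_filter.2 ⟨hx, hkx⟩))
      linarith [mul_nonneg hc (hnn ((permitted par r).filter (fun x => 1 ≤ subSize par x.2)))]
    · push Not at hbig
      have hsum : ∑ x ∈ (permitted par r).filter (fun x => s x.1 x.2 = true), subSize par x.2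
          ≤ ((permitted par r).filter (fun x => s x.1 x.2 = true)).card * k := by
        rw [← smul_eq_mul]
        refine sum_le_card_nsmul _ _ _ fun x hx => ?_
        obtain ⟨hxp, hsx⟩ := mem_filter.1 hx
        by_contra hcon
        exact hbig x hxp (by omega) hsx
      have hcard : ∑ x ∈ (permitted par r).filter (fun x => 1 ≤ subSize par x.2),
          (if s x.1 x.2 = true then (1 : ℝ) else 0)
          = ((permitted par r).filter (fun x => s x.1 x.2 = true)).card := by
        simp only [one_le_subSize, filter_true, sum_boole]
      have h3 : (K : ℝ) ≤ ((permitted par r).filter (fun x => s x.1 x.2 = true)).card * k := by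
        exact_mod_cast (hlt.trans_le hsum).le
      rw [hcard]
      have h4 : 1 ≤ (k : ℝ) / K *
          ((permitted par r).filter (fun x => s x.1 x.2 = true)).card := by
        rw [div_mul_eq_mul_div, le_div_iff₀ hK0]
        linarith
      linarith [hnn ((permitted par r).filter (fun x => k ≤ subSize par x.2))]
  have hexp : ∀ j : ℕ, ∑ s : Fin m → Fin m → Bool, surpW p par r s *
      ∑ x ∈ (permitted par r).filter (fun x => j ≤ subSize par x.2),
          (if s x.1 x.2 = true then (1 : ℝ) else 0) ≤ p * siblingSum r j par := by
    intro j
    simp only [mul_sum]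
    rw [sum_comm, sum_congr rfl fun x hx => sum_surpW_mul_indicator (mem_filter.1 hx).1,
      sum_const, nsmul_eq_mul, mul_comm]
    exact mul_le_mul_of_nonneg_left (card_permitted_le j) h0
  calc _ ≤ ∑ s : Fin m → Fin m → Bool, surpW p par r s * _ :=
        sum_le_sum fun s _ => mul_le_mul_of_nonneg_left (hpt s) (surpW_nonneg h0 h1 s)
    _ = ∑ s : Fin m → Fin m → Bool, surpW p par r s *
          ∑ x ∈ (permitted par r).filter (fun x => k ≤ subSize par x.2),
            (if s x.1 x.2 = true then (1 : ℝ) else 0) +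
        (k : ℝ) / K * ∑ s : Fin m → Fin m → Bool, surpW p par r s *
          ∑ x ∈ (permitted par r).filter (fun x => 1 ≤ subSize par x.2),
            (if s x.1 x.2 = true then (1 : ℝ) else 0) := by
        rw [mul_sum (s := univ), ← sum_add_distrib]
        exact sum_congr rfl fun s _ => by ring
    _ ≤ p * siblingSum r k par + (k : ℝ) / K * (p * siblingSum r 1 par) := by
        gcongr
        · exact hexp k
        · exact hexp 1
    _ = _ := by ring

theorem descSumProb_nonneg (m : ℕ) (h0 : 0 ≤ p) (h1 : p ≤ 1) (K : ℕ) :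
    0 ≤ descSumProb m p K := by
  unfold descSumProb
  split_ifs
  · refine div_nonneg (sum_nonneg fun par _ => sum_nonneg fun s _ => ?_) (Nat.cast_nonneg _)
    refine mul_nonneg (mul_nonneg ?_ (surpW_nonneg h0 h1 s)) ?_ <;> split_ifs <;> norm_num
  · exact le_rfl

theorem descSumProb_le (m : ℕ) (h0 : 0 ≤ p) (h1 : p ≤ 1) {k K : ℕ} (hk : 1 ≤ k) (hK : 0 < K) :
    descSumProb m p K ≤ 48 * Real.exp 1 * (p * ((m : ℝ) * √(m : ℝ))) *
      (1 / √(k : ℝ) + (k : ℝ) / K) := by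
  unfold descSumProb
  split_ifs with hm
  swap
  · positivity
  dsimp only
  generalize (⟨0, hm⟩ : Fin m) = r
  have hm0 : (0 : ℝ) < m := by exact_mod_cast hm
  have hcard : (0 : ℝ) < (treeFinset m r).card := by
    rw [card_treeFinset]; positivity
  rw [div_le_iff₀ hcard]
  calc _ = ∑ par ∈ treeFinset m r, ∑ s : Fin m → Fin m → Bool, surpW p par r s *
        (if K < ∑ x ∈ (permitted par r).filter (fun x => s x.1 x.2 = true),
            subSize par x.2 then 1 else 0) := by
        rw [treeFinset, sum_filter]
        refine sum_congr rfl fun par _ => ?_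
        split_ifs <;> simp
    _ ≤ ∑ par ∈ treeFinset m r, p * (siblingSum r k par + (k : ℝ) / K * siblingSum r 1 par) :=
        sum_le_sum fun par _ => sum_surpW_le hK h0 h1
    _ = p * (∑ par ∈ treeFinset m r, siblingSum r k par +
          (k : ℝ) / K * ∑ par ∈ treeFinset m r, siblingSum r 1 par) := by
        rw [← mul_sum, sum_add_distrib, mul_sum]
    _ ≤ p * (48 * Real.exp 1 * ((m : ℝ) * √(m : ℝ)) / √(k : ℝ) * (treeFinset m r).card +
          (k : ℝ) / K * (48 * Real.exp 1 * ((m : ℝ) * √(m : ℝ)) / √((1 : ℕ) : ℝ) *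
            (treeFinset m r).card)) := by
        gcongr
        · exact sum_siblingSum_le_card r hk
        · exact sum_siblingSum_le_card r le_rfl
    _ = _ := by
        rw [Nat.cast_one, Real.sqrt_one]
        ring

end Probability

end RandomTree

open RandomTree Filter in
/-- Fix `σ > 0` and `p = p(m)` with `m · p(m)^{2/3} → σ`.  Let `𝖳_m` be
a uniformly random labelled tree on `[m]` rooted at `1` with its canonical planar
embedding, to which each permitted edge is added independently with probability `p(m)`;
let `𝖱(m)` be the number of added (surplus) edges, and `𝖶ᵢ(m)` the number of descendants
(in `𝖳_m`, inclusively) of the head of the `i`-th surplus edge.  Then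
`lim_{K→∞} limsup_{m→∞} P[Σ_{i=1}^{𝖱(m)} 𝖶ᵢ(m) > K] = 0`. -/
theorem surplus_descendant_sum_tight
    (σ : ℝ) (hσ : 0 < σ) (p : ℕ → ℝ) (hp : ∀ m, 0 ≤ p m ∧ p m ≤ 1)
    (hσlim : Tendsto (fun m : ℕ => (m : ℝ) * (p m) ^ ((2:ℝ)/3)) atTop (nhds σ)) :
    Tendsto (fun K : ℕ =>
      Filter.limsup (fun m : ℕ => descSumProb m (p m) K) atTop) atTop (nhds 0) := by
  have hbound : ∀ᶠ m : ℕ in atTop, p m * ((m : ℝ) * √(m : ℝ)) ≤ σ ^ ((3 : ℝ) / 2) + 1 := by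
    have h1 : Tendsto (fun m : ℕ => ((m : ℝ) * (p m) ^ ((2 : ℝ) / 3)) ^ ((3 : ℝ) / 2)) atTop
        (nhds (σ ^ ((3 : ℝ) / 2))) := hσlim.rpow_const (Or.inl hσ.ne')
    filter_upwards [h1.eventually_le_const (lt_add_one _)] with m hm
    refine le_trans (le_of_eq ?_) hm
    have hm0 : (0 : ℝ) ≤ m := Nat.cast_nonneg m
    rw [Real.mul_rpow hm0 (Real.rpow_nonneg (hp m).1 _), ← Real.rpow_mul (hp m).1,
      show (2 : ℝ) / 3 * (3 / 2) = 1 by norm_num, Real.rpow_one,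
      show (3 : ℝ) / 2 = 1 + 1 / 2 by norm_num,
      Real.rpow_add_of_nonneg hm0 (by norm_num) (by norm_num), Real.rpow_one,
      ← Real.sqrt_eq_rpow, mul_comm]
  set M := 48 * Real.exp 1 * (σ ^ ((3 : ℝ) / 2) + 1) with hM
  have hM0 : 0 ≤ M := by positivity
  have hev : ∀ K : ℕ, 0 < K → ∀ᶠ m : ℕ in atTop,
      descSumProb m (p m) K ≤ M * (2 / √(Nat.sqrt K : ℝ)) := by
    intro K hK
    filter_upwards [hbound] with m hm
    have hk : 1 ≤ Nat.sqrt K := Nat.sqrt_pos.2 hK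
    refine (descSumProb_le m (hp m).1 (hp m).2 hk hK).trans ?_
    have hk1 : (1 : ℝ) ≤ Nat.sqrt K := by exact_mod_cast hk
    have hK0 : (0 : ℝ) < K := by exact_mod_cast hK
    have hs : 0 < √(Nat.sqrt K : ℝ) := Real.sqrt_pos.2 (by linarith)
    have hkK : (Nat.sqrt K : ℝ) / K ≤ 1 / √(Nat.sqrt K : ℝ) := by
      rw [div_le_div_iff₀ hK0 hs, one_mul]
      have h1 : √(Nat.sqrt K : ℝ) ≤ Nat.sqrt K := 
        Real.sqrt_le_iff.2 ⟨by linarith, by nlinarith⟩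
      have h2 : (Nat.sqrt K : ℝ) * Nat.sqrt K ≤ K := by exact_mod_cast Nat.sqrt_le K
      nlinarith
    rw [hM]
    refine mul_le_mul (by gcongr) ?_ (by positivity) (by positivity)
    calc 1 / √(Nat.sqrt K : ℝ) + (Nat.sqrt K : ℝ) / K
        ≤ 1 / √(Nat.sqrt K : ℝ) + 1 / √(Nat.sqrt K : ℝ) := by gcongr
      _ = 2 / √(Nat.sqrt K : ℝ) := by ring
  have hlim : Tendsto (fun K : ℕ => M * (2 / √(Nat.sqrt K : ℝ))) atTop (nhds 0) := by
    rw [← mul_zero M]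
    refine Tendsto.const_mul M (Tendsto.const_div_atTop ?_ 2)
    refine Real.tendsto_sqrt_atTop.comp (tendsto_natCast_atTop_atTop.comp ?_)
    exact tendsto_atTop.2 fun b => (eventually_ge_atTop (b * b)).mono
      fun K hK => Nat.le_sqrt.2 hK
  have hnn : ∀ K m : ℕ, 0 ≤ descSumProb m (p m) K :=
    fun K m => descSumProb_nonneg m (hp m).1 (hp m).2 K
  refine tendsto_of_tendsto_of_tendsto_of_le_of_le' tendsto_const_nhds hlim ?_ ?_
  · filter_upwards [eventually_gt_atTop 0] with K hK
    exact le_limsup_of_frequently_le (Frequently.of_forall fun m => hnn K m)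
      (isBoundedUnder_of_eventually_le (hev K hK))
  · filter_upwards [eventually_gt_atTop 0] with K hK
    exact limsup_le_of_le (isCoboundedUnder_le_of_le atTop (hnn K)) (hev K hK)
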